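/- Let ξ : Ω → ℝ^d be a discrete random vector on a probability space (Ω, 𝒜, P) (i.e., ξ has countable range) with E(‖ξ‖) < ∞, and let D ⊆ ℝ^d be a Borel measurable convex set with P(ξ ∈ D) = 1. Then for every convex function f : D → ℝ (not assumed continuous), E(f(ξ)) is well-defined as an element of (−∞, ∞] and f(E(ξ)) ≤ E(f(ξ)). -/

import Mathlib

open MeasureTheory Set Module

/-- A convex function on a finite-dimensional space has a subgradient at every interior point
of its domain. -/
theorem ConvexOn.exists_subgradient_of_mem_interior {V : Type*} [NormedAddCommGroup V]
    [NormedSpace ℝ V] [FiniteDimensional ℝ V] {s : Set V} {g : V → ℝ} {a : V}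
    (hg : ConvexOn ℝ s g) (ha : a ∈ interior s) :
    ∃ l : V →ₗ[ℝ] ℝ, ∀ x ∈ s, g a + l (x - a) ≤ g x := by
  have hcont := hg.continuousOn_interior
  have hg' : ConvexOn ℝ (interior s) g := hg.subset interior_subset hg.1.interior
  have hopen : IsOpen {p : V × ℝ | p.1 ∈ interior s ∧ g p.1 < p.2} := by
    have h1 : IsOpen (Prod.fst ⁻¹' interior s : Set (V × ℝ)) :=
      isOpen_interior.preimage continuous_fst
    have h2 : ContinuousOn (fun p : V × ℝ => p.2 - g p.1) (Prod.fst ⁻¹' interior s) :=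
      continuousOn_snd.sub (hcont.comp continuousOn_fst fun _ hp => hp)
    have h3 := h2.isOpen_inter_preimage h1 (isOpen_Ioi (a := (0 : ℝ)))
    convert h3 using 1
    ext p
    simp
  obtain ⟨L, hL⟩ := geometric_hahn_banach_point_open hg'.convex_strict_epigraph hopen
    (x := (a, g a)) (by simp)
  have hsplit : ∀ (x : V) (t : ℝ), L (x, t) = L (x, 0) + t * L (0, 1) := by
    intro x t
    rw [← smul_eq_mul, ← map_smul, ← map_add]
    simp
  set c := L (0, 1) with hc
  have hcpos : 0 < c := by
    have := hL (a, g a + 1) ⟨ha, by simp⟩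
    rw [hsplit a (g a), hsplit a (g a + 1)] at this
    linarith
  have key : ∀ x ∈ interior s, L (a, 0) + g a * c ≤ L (x, 0) + g x * c := by
    intro x hx
    refine le_of_forall_pos_le_add fun ε hε => ?_
    have := hL (x, g x + ε / c) ⟨hx, by simp only; linarith [div_pos hε hcpos]⟩
    rw [hsplit a (g a), hsplit x _, add_mul, div_mul_cancel₀ _ hcpos.ne'] at this
    linarith
  let l₀ : V →ₗ[ℝ] ℝ := L.toLinearMap ∘ₗ LinearMap.inl ℝ V ℝ
  have hl₀ : ∀ x, L (x, 0) = l₀ x := fun x => rfl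
  refine ⟨-(c⁻¹ • l₀), fun x hx => ?_⟩
  have hmem : (1 / 2 : ℝ) • a + (1 / 2 : ℝ) • x ∈ interior s :=
    hg.1.openSegment_interior_self_subset_interior ha hx
      ⟨1 / 2, 1 / 2, by norm_num, by norm_num, by norm_num, rfl⟩
  have h1 := key _ hmem
  have h2 := hg.2 (interior_subset ha) hx (by norm_num : (0 : ℝ) ≤ 1 / 2)
    (by norm_num : (0 : ℝ) ≤ 1 / 2) (by norm_num)
  have h3 := mul_le_mul_of_nonneg_right h2 hcpos.le
  simp only [hl₀, map_add, map_smul, smul_eq_mul] at h1 h3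
  simp only [LinearMap.neg_apply, LinearMap.smul_apply, smul_eq_mul, map_sub]
  have h4 : l₀ a - l₀ x + g a * c ≤ g x * c := by linarith
  have h5 : c⁻¹ * (l₀ a - l₀ x + g a * c) ≤ c⁻¹ * (g x * c) :=
    mul_le_mul_of_nonneg_left h4 (inv_pos.2 hcpos).le
  have h6 : ∀ y : ℝ, c⁻¹ * (y * c) = y := fun y => by field_simp
  rw [mul_add, h6, h6] at h5
  linarith

/-- If the origin is not interior to a nonempty convex set in a finite-dimensional space, then some
nonzero linear functional is nonnegative on this set. -/
theorem Convex.exists_ne_zero_nonneg_of_zero_notMem_interior {V : Type*} [NormedAddCommGroup V]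
    [NormedSpace ℝ V] [FiniteDimensional ℝ V] {s : Set V} (hs : Convex ℝ s) (hne : s.Nonempty)
    (h0 : (0 : V) ∉ interior s) :
    ∃ l : V →ₗ[ℝ] ℝ, l ≠ 0 ∧ ∀ x ∈ s, 0 ≤ l x := by
  by_cases hint : (interior s).Nonempty
  · obtain ⟨l, hl, hle⟩ := geometric_hahn_banach_of_nonempty_interior_point hs h0 hint
    refine ⟨-l.toLinearMap, fun h => hl ?_, fun x hx => by simpa using hle x hx⟩
    ext x
    simpa using LinearMap.congr_fun h x
  · rw [hs.interior_nonempty_iff_affineSpan_eq_top,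
      AffineSubspace.affineSpan_eq_top_iff_vectorSpan_eq_top_of_nonempty ℝ V V hne] at hint
    obtain ⟨l, hl, hker⟩ := Submodule.exists_le_ker_of_lt_top _ (lt_top_iff_ne_top.2 hint)
    obtain ⟨y, hy⟩ := hne
    have hconst : ∀ x ∈ s, l x = l y := fun x hx => by
      have : l (x - y) = 0 := hker (vsub_mem_vectorSpan ℝ hx hy)
      rwa [map_sub, sub_eq_zero] at this
    rcases le_total 0 (l y) with h | h
    · exact ⟨l, hl, fun x hx => by rwa [hconst x hx]⟩
    · exact ⟨-l, neg_ne_zero.2 hl, fun x hx => by simpa [hconst x hx] using h⟩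

/-- Let `X` be an integrable random vector with values in a finite-dimensional space, lying almost
surely in a convex set `C`. Then `𝔼 X ∈ C`, and every convex function on `C` has an affine
minorant that is exact at `𝔼 X` and valid at almost every value of `X`. Neither `C` nor the
function needs to be measurable. -/
theorem ConvexOn.exists_ae_subgradient_integral {Ω : Type*} [MeasurableSpace Ω] {P : Measure Ω}
    [IsProbabilityMeasure P] {E : Type*} [NormedAddCommGroup E] [NormedSpace ℝ E]
    [FiniteDimensional ℝ E] {X : Ω → E} (hX : Integrable X P) {C : Set E} {f : E → ℝ}
    (hf : ConvexOn ℝ C f) (hXC : ∀ᵐ ω ∂P, X ω ∈ C) :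
    ∫ ω, X ω ∂P ∈ C ∧ ∃ l : E →ₗ[ℝ] ℝ,
      ∀ᵐ ω ∂P, f (∫ ω, X ω ∂P) + l (X ω - ∫ ω, X ω ∂P) ≤ f (X ω) := by
  set m := ∫ ω, X ω ∂P with hm
  suffices H : ∀ (n : ℕ) (V : Submodule ℝ E), finrank ℝ V = n → (∀ᵐ ω ∂P, X ω - m ∈ V) →
      m ∈ C ∧ ∃ l : E →ₗ[ℝ] ℝ, ∀ᵐ ω ∂P, f m + l (X ω - m) ≤ f (X ω) from
    H _ ⊤ rfl (by simp)
  intro n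
  induction n using Nat.strong_induction_on with
  | _ n ih =>
    intro V hV hXV
    let T : V →ᵃ[ℝ] E := V.subtype.toAffineMap + AffineMap.const ℝ V m
    have hT : ∀ v : V, T v = v + m := fun v => rfl
    have hfT : ConvexOn ℝ (T ⁻¹' C) (f ∘ T) := hf.comp_affineMap T
    have hmem : ∀ ω (h : X ω - m ∈ V), T ⟨X ω - m, h⟩ = X ω := fun ω h => by simp [hT]
    by_cases h0 : (0 : V) ∈ interior (T ⁻¹' C)
    · obtain ⟨l, hl⟩ := hfT.exists_subgradient_of_mem_interior h0
      obtain ⟨l', hl'⟩ := LinearMap.exists_extend l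
      refine ⟨by simpa [hT] using interior_subset h0, l', ?_⟩
      filter_upwards [hXV, hXC] with ω hω hωC
      have := hl ⟨X ω - m, hω⟩ (by rwa [mem_preimage, hmem])
      rw [Function.comp_apply, Function.comp_apply, hmem, sub_zero, ← hl'] at this
      simpa [hT] using this
    · have hne : (T ⁻¹' C).Nonempty := by
        obtain ⟨ω, hω, hωC⟩ := (hXV.and hXC).exists
        exact ⟨⟨X ω - m, hω⟩, by rwa [mem_preimage, hmem]⟩
      obtain ⟨l, hl0, hl⟩ := hfT.1.exists_ne_zero_nonneg_of_zero_notMem_interior hne h0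
      obtain ⟨l', hl'⟩ := LinearMap.exists_extend l
      have hXm : Integrable (fun ω => X ω - m) P := hX.sub (integrable_const m)
      have hint : Integrable (fun ω => l' (X ω - m)) P :=
        (LinearMap.toContinuousLinearMap l').integrable_comp hXm
      have hzero : ∫ ω, l' (X ω - m) ∂P = 0 := by
        have := (LinearMap.toContinuousLinearMap l').integral_comp_comm hXm
        rw [integral_sub hX (integrable_const m)] at this
        simpa [← hm] using this
      have hnonneg : 0 ≤ᵐ[P] fun ω => l' (X ω - m) := by
        filter_upwards [hXV, hXC] with ω hω hωC
        have := hl ⟨X ω - m, hω⟩ (by rwa [mem_preimage, hmem])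
        rwa [← hl'] at this
      have hker := (integral_eq_zero_iff_of_nonneg_ae hnonneg hint).1 hzero
      have hlt : V ⊓ LinearMap.ker l' < V := by
        refine lt_of_le_of_ne inf_le_left fun h => hl0 ?_
        ext v
        have hv : (v : E) ∈ LinearMap.ker l' := inf_eq_left.1 h v.2
        rw [← hl']
        simpa using hv
      refine ih _ (hV ▸ Submodule.finrank_lt_finrank_of_lt hlt) (V ⊓ LinearMap.ker l') rfl ?_
      filter_upwards [hXV, hker] with ω hω hω'
      exact ⟨hω, hω'⟩


/-- Jensen inequality for discrete random vectors: if `ξ : Ω → ℝ^d` has countable range,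
`E‖ξ‖ < ∞`, `D` is a Borel measurable convex set with `P(ξ ∈ D) = 1`, and `f : D → ℝ` is
convex (not assumed continuous), then `E(f(ξ))` is well-defined in `(−∞,∞]` and
`f(E ξ) ≤ E(f(ξ))`. -/
theorem stmt_6 (d : ℕ) {Ω : Type*} [MeasurableSpace Ω] (P : MeasureTheory.Measure Ω)
    [MeasureTheory.IsProbabilityMeasure P] (ξ : Ω → EuclideanSpace ℝ (Fin d))
    (hmeas : Measurable ξ) (hcount : (Set.range ξ).Countable)
    (hint : MeasureTheory.Integrable ξ P)
    (D : Set (EuclideanSpace ℝ (Fin d))) (hDmeas : MeasurableSet D) (hDconv : Convex ℝ D)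
    (hae : ∀ᵐ ω ∂P, ξ ω ∈ D)
    (f : EuclideanSpace ℝ (Fin d) → ℝ) (hfconv : ConvexOn ℝ D f) :
    MeasureTheory.Integrable (fun ω => max (-(f (ξ ω))) 0) P ∧
      (MeasureTheory.Integrable (fun ω => f (ξ ω)) P →
        f (∫ ω, ξ ω ∂P) ≤ ∫ ω, f (ξ ω) ∂P) := by
  obtain ⟨-, l, hl⟩ := hfconv.exists_ae_subgradient_integral hint hae
  set m := ∫ ω, ξ ω ∂P with hm
  have hξm : Integrable (fun ω => ξ ω - m) P := hint.sub (integrable_const m)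
  have hlint : Integrable (fun ω => l (ξ ω - m)) P :=
    (LinearMap.toContinuousLinearMap l).integrable_comp hξm
  have hlzero : ∫ ω, l (ξ ω - m) ∂P = 0 := by
    have := (LinearMap.toContinuousLinearMap l).integral_comp_comm hξm
    rw [integral_sub hint (integrable_const m)] at this
    simpa [← hm] using this
  have haff : Integrable (fun ω => f m + l (ξ ω - m)) P := (integrable_const _).add hlint
  have hfmeas : Measurable fun ω => f (ξ ω) := by
    intro t _
    have : (fun ω => f (ξ ω)) ⁻¹' t = ξ ⁻¹' (f ⁻¹' t ∩ range ξ) := by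
      ext ω
      simp
    rw [this]
    exact hmeas (hcount.mono inter_subset_right).measurableSet
  refine ⟨haff.mono (hfmeas.neg.max measurable_const).aestronglyMeasurable ?_, fun hfint => ?_⟩
  · filter_upwards [hl] with ω hω
    rw [Real.norm_of_nonneg (le_max_right _ _), Real.norm_eq_abs]
    exact max_le (by linarith [neg_abs_le (f m + l (ξ ω - m))]) (abs_nonneg _)
  · calc f m = ∫ ω, (f m + l (ξ ω - m)) ∂P := by
          rw [integral_add (integrable_const _) hlint, hlzero]
          simp
      _ ≤ ∫ ω, f (ξ ω) ∂P := integral_mono_ae haff hfint hl
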